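/- arXiv:2512.16733 — 2 statements merged into one kernel-verified Lean document; each statement's English description precedes it below -/
import Mathlib

section
/- Let D* be a dataset such that for every abstract state s and every capability c there exists a state s' with (s, c, s') ∈ D*. Then the pessimistic model and the optimistic model built from D* are equivalent, and both entail exactly the transitions of D*. -/
/-- The effect of a transition from `s` to `s'`: atoms added and atoms deleted. -/
def eta {Atom : Type*} [DecidableEq Atom] (s s' : Finset Atom) :
    Finset Atom × Finset Atom :=
  (s' \ s, s \ s')

/-- Applying an effect pair `(A, B)` to a state `s` gives `(s \ B) ∪ A`. -/
def applyEff {Atom : Type*} [DecidableEq Atom] (s : Finset Atom)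
    (e : Finset Atom × Finset Atom) : Finset Atom :=
  (s \ e.2) ∪ e.1

/-- The set of effects observed for capability `c` from state `s` in dataset `D`. -/
def etaSet {Atom C : Type*} [DecidableEq Atom] [DecidableEq C] (c : C) (s : Finset Atom)
    (D : Finset (Finset Atom × C × Finset Atom)) : Finset (Finset Atom × Finset Atom) :=
  (D.filter (fun t => t.1 = s ∧ t.2.1 = c)).image (fun t => eta t.1 t.2.2)

/-- A state `s` is observed for `c` in `D` iff some effect was observed. -/
def observedFor {Atom C : Type*} [DecidableEq Atom] [DecidableEq C] (c : C) (s : Finset Atom)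
    (D : Finset (Finset Atom × C × Finset Atom)) : Prop :=
  (etaSet c s D).Nonempty

/-- The pessimistic model built from `D` entails the transition `(s, c, s')`. -/
def pessEntails {Atom C : Type*} [DecidableEq Atom] [DecidableEq C]
    (D : Finset (Finset Atom × C × Finset Atom))
    (s : Finset Atom) (c : C) (s' : Finset Atom) : Prop :=
  ∃ e ∈ etaSet c s D, applyEff s e = s'

/-- The optimistic model built from `D` entails the transition `(s, c, s')`. -/
def optEntails {Atom C : Type*} [DecidableEq Atom] [DecidableEq C]
    (D : Finset (Finset Atom × C × Finset Atom))
    (s : Finset Atom) (c : C) (s' : Finset Atom) : Prop :=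
  ∃ s0 : Finset Atom, observedFor c s0 D ∧
    (etaSet c s D = ∅ ∨ etaSet c s D = etaSet c s0 D) ∧
    ∃ e ∈ etaSet c s0 D, applyEff s e = s'

theorem applyEff_eta {Atom : Type*} [DecidableEq Atom] (s s' : Finset Atom) :
    applyEff s (eta s s') = s' := by
  ext a
  simp only [applyEff, eta, Finset.mem_union, Finset.mem_sdiff]
  tauto

theorem mem_etaSet {Atom C : Type*} [DecidableEq Atom] [DecidableEq C] {c : C}
    {s : Finset Atom} {D : Finset (Finset Atom × C × Finset Atom)}
    {e : Finset Atom × Finset Atom} :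
    e ∈ etaSet c s D ↔ ∃ s', (s, c, s') ∈ D ∧ eta s s' = e := by
  simp only [etaSet, Finset.mem_image, Finset.mem_filter]
  constructor
  · rintro ⟨⟨_, _, s'⟩, ⟨h, rfl, rfl⟩, rfl⟩
    exact ⟨s', h, rfl⟩
  · rintro ⟨s', h, rfl⟩
    exact ⟨(s, c, s'), ⟨h, rfl, rfl⟩, rfl⟩

/-- The pessimistic model of any dataset entails exactly the transitions of the dataset. -/
theorem pessEntails_iff_mem {Atom C : Type*} [DecidableEq Atom] [DecidableEq C]
    {D : Finset (Finset Atom × C × Finset Atom)} {s s' : Finset Atom} {c : C} :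
    pessEntails D s c s' ↔ (s, c, s') ∈ D := by
  constructor
  · rintro ⟨e, he, rfl⟩
    obtain ⟨s', h, rfl⟩ := mem_etaSet.1 he
    rwa [applyEff_eta]
  · intro h
    exact ⟨eta s s', mem_etaSet.2 ⟨s', h, rfl⟩, applyEff_eta s s'⟩

/-- At a state observed for `c`, the pessimistic and optimistic models agree. -/
theorem pessEntails_iff_optEntails_of_observedFor {Atom C : Type*} [DecidableEq Atom]
    [DecidableEq C] {D : Finset (Finset Atom × C × Finset Atom)} {s s' : Finset Atom} {c : C}
    (hs : observedFor c s D) : pessEntails D s c s' ↔ optEntails D s c s' := by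
  constructor
  · intro h
    exact ⟨s, hs, Or.inr rfl, h⟩
  · rintro ⟨s0, -, h | h, he⟩
    · exact absurd h hs.ne_empty
    · rwa [pessEntails, h]

/-- If `D*` contains a transition from every state for every capability, then
the pessimistic and optimistic models built from `D*` are equivalent and both
entail exactly the transitions of `D*`. -/
theorem models_coincide_on_full_dataset {Atom C : Type*} [Fintype Atom] [DecidableEq Atom]
    [Fintype C] [DecidableEq C]
    (Dstar : Finset (Finset Atom × C × Finset Atom))
    (hfull : ∀ (s : Finset Atom) (c : C), ∃ s' : Finset Atom, (s, c, s') ∈ Dstar) :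
    (∀ (s : Finset Atom) (c : C) (s' : Finset Atom),
        pessEntails Dstar s c s' ↔ optEntails Dstar s c s') ∧
    (∀ (s : Finset Atom) (c : C) (s' : Finset Atom),
        pessEntails Dstar s c s' ↔ (s, c, s') ∈ Dstar) ∧
    (∀ (s : Finset Atom) (c : C) (s' : Finset Atom),
        optEntails Dstar s c s' ↔ (s, c, s') ∈ Dstar) := by
  have hobs (s : Finset Atom) (c : C) : observedFor c s Dstar := by
    obtain ⟨s', h⟩ := hfull s c
    exact ⟨eta s s', mem_etaSet.2 ⟨s', h, rfl⟩⟩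
  exact ⟨fun s c _ => pessEntails_iff_optEntails_of_observedFor (hobs s c),
    fun _ _ _ => pessEntails_iff_mem,
    fun s c _ => (pessEntails_iff_optEntails_of_observedFor (hobs s c)).symm.trans
      pessEntails_iff_mem⟩
end

section
/- (Theorem 3, dataset identification) Let D ⊆ D* be datasets such that: (i) for every abstract state s and every capability c there exists s' with (s, c, s') ∈ D*; (ii) every capability c has at least one state observed for c in D; and (iii) for every state s and capability c, if s is observed for c in D then every transition (s, c, s') ∈ D* also lies in D. If the pessimistic and optimistic models built from D are equivalent, then D = D*. -/
/-- Theorem 3 (dataset identification): under assumptions (i)–(iii), if the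
pessimistic and optimistic models built from `D` are equivalent, then `D = D*`. -/
theorem equiv_models_imply_full_dataset {Atom C : Type*} [Fintype Atom] [DecidableEq Atom]
    [Fintype C] [DecidableEq C]
    (D Dstar : Finset (Finset Atom × C × Finset Atom))
    (hsub : D ⊆ Dstar)
    (hfull : ∀ (s : Finset Atom) (c : C), ∃ s' : Finset Atom, (s, c, s') ∈ Dstar)
    (hobs : ∀ c : C, ∃ s : Finset Atom, observedFor c s D)
    (heff : ∀ (s : Finset Atom) (c : C), observedFor c s D →
      ∀ s' : Finset Atom, (s, c, s') ∈ Dstar → (s, c, s') ∈ D)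
    (hequiv : ∀ (s : Finset Atom) (c : C) (s' : Finset Atom),
      pessEntails D s c s' ↔ optEntails D s c s') :
    D = Dstar := by
  refine Finset.Subset.antisymm hsub ?_
  rintro ⟨s, c, s'⟩ h
  refine heff s c ?_ s' h
  by_contra hs
  have hempty : etaSet c s D = ∅ := Finset.not_nonempty_iff_eq_empty.mp hs
  obtain ⟨s0, hs0⟩ := hobs c
  obtain ⟨e, he⟩ := id hs0
  obtain ⟨e', he', -⟩ :=
    (hequiv s c (applyEff s e)).mpr ⟨s0, hs0, Or.inl hempty, e, he, rfl⟩
  exact hs ⟨e', he'⟩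
end
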